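/- (L^1 bound for the fractional derivative of the mollification kernel, Step 5 of the proof of Theorem 4.2.) There exists a constant C > 0 such that for every τ > 0, ∫_{ℝ^{1+2d}} | ∫_{ℝ^d} (2K_τ(s,y,w) − K_τ(s,y+h,w) − K_τ(s,y−h,w)) |h|^{−d−1/3} dh | ds dy dw ≤ C τ^{−1}; that is, ‖𝔇_y K_τ‖_{L^1(ℝ^{1+2d})} ≤ C τ^{−1}, where 𝔇_y denotes the order-1/3 symmetric-difference singular integral acting in the spatial kernel variable y. -/

import Mathlib

open MeasureTheory Real ENNReal
open scoped RealInnerProductSpace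

noncomputable section

/-- Euclidean space `ℝ^d`. -/
abbrev V (d : ℕ) : Type := EuclideanSpace ℝ (Fin d)

/-- The kinetic phase space `ℝ^{1+2d}`, with points `(t, x, v)`. -/
abbrev Pt (d : ℕ) : Type := ℝ × V d × V d

/-- Kinetic composition `(t,x,v) ∘ (s,y,w) = (t+s, x+y+s v, v+w)`. -/
def kmul {d : ℕ} (a b : Pt d) : Pt d :=
  (a.1 + b.1, a.2.1 + b.2.1 + b.1 • a.2.2, a.2.2 + b.2.2)

/-- Kinetic inverse `(t,x,v)⁻¹ = (−t, −x+t v, −v)`. -/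
def kinv {d : ℕ} (a : Pt d) : Pt d :=
  (-a.1, -a.2.1 + a.1 • a.2.2, -a.2.2)

/-- `g₁(r) = r³ sin(log r)`, extended by `0` at `r = 0`. -/
def g1 (r : ℝ) : ℝ := r ^ 3 * Real.sin (Real.log r)

/-- `g₂(r) = r³ cos(log r)`, extended by `0` at `r = 0`. -/
def g2 (r : ℝ) : ℝ := r ^ 3 * Real.cos (Real.log r)

/-- `ġ₁(r)/(2r) = (r/2)(3 sin(log r) + cos(log r))`, extended by `0` at `r = 0`. -/
def h1 (r : ℝ) : ℝ := r / 2 * (3 * Real.sin (Real.log r) + Real.cos (Real.log r))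

/-- `ġ₂(r)/(2r) = (r/2)(3 cos(log r) − sin(log r))`, extended by `0` at `r = 0`. -/
def h2 (r : ℝ) : ℝ := r / 2 * (3 * Real.cos (Real.log r) - Real.sin (Real.log r))

/-- The matrix `W(r)`, recorded through its scalar block entries as a `2×2` real matrix;
the full `2d×2d` matrix is the blockwise tensor with `Id_d`. -/
def Wm (r : ℝ) : Matrix (Fin 2) (Fin 2) ℝ := !![g1 r, g2 r; h1 r, h2 r]

/-- The matrix `D_δ` (scalar block entries). -/
def Dm (δ : ℝ) : Matrix (Fin 2) (Fin 2) ℝ := !![δ, 0; 0, 1]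

/-- The matrix `E_δ(r)` (scalar block entries). -/
def Em (δ r : ℝ) : Matrix (Fin 2) (Fin 2) ℝ := !![1, δ * r ^ 2; 0, 1]

/-- `A_{m₀}(r) = D_{m₀} W(r) D_{m₀}⁻¹` (scalar block entries). -/
def Am (m0 r : ℝ) : Matrix (Fin 2) (Fin 2) ℝ := Dm m0 * Wm r * (Dm m0)⁻¹

/-- The action on `ℝ^d × ℝ^d` of a `2×2` block matrix whose blocks are the scalar
multiples of `Id_d` given by the entries of `M`. -/
def act {d : ℕ} (M : Matrix (Fin 2) (Fin 2) ℝ) (p : V d × V d) : V d × V d :=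
  (M 0 0 • p.1 + M 0 1 • p.2, M 1 0 • p.1 + M 1 1 • p.2)

/-- The kinetic trajectory `γ^m(r; (t,x,v))`. -/
def gammaK {d : ℕ} (m : Pt d) (z : Pt d) (r : ℝ) : Pt d :=
  (z.1 + m.1 * r ^ 2,
   (act (Em m.1 r) (z.2.1, z.2.2) + act (Am m.1 r) (m.2.1, m.2.2)).1,
   (act (Em m.1 r) (z.2.1, z.2.2) + act (Am m.1 r) (m.2.1, m.2.2)).2)

/-- Build a vector of `ℝ^d` from components. -/
def mkV {d : ℕ} (f : Fin d → ℝ) : V d := (EuclideanSpace.equiv (Fin d) ℝ).symm f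

/-- The argument `(s/r², A_{s/r²}(r)⁻¹ (y,w)ᵀ)` fed into `ψ`. -/
def psiArg {d : ℕ} (r : ℝ) (m : Pt d) : Pt d :=
  (m.1 / r ^ 2,
   (act ((Am (m.1 / r ^ 2) r)⁻¹) (m.2.1, m.2.2)).1,
   (act ((Am (m.1 / r ^ 2) r)⁻¹) (m.2.1, m.2.2)).2)

/-- The mollification kernel `K_r(s,y,w) = 2^d r^{−Q} ψ(s/r², A_{s/r²}(r)⁻¹(y,w)ᵀ)`,
with `Q = 4d+2`. -/
def Kker {d : ℕ} (ψ : Pt d → ℝ) (r : ℝ) (m : Pt d) : ℝ :=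
  2 ^ d * r ^ (-(4 * (d : ℤ) + 2)) * ψ (psiArg r m)

/-- The kernel `K̃_r(s,y,w) = −2^{d+1} s r^{−Q−1} ψ(s/r², A_{s/r²}(r)⁻¹(y,w)ᵀ)`. -/
def Ktil {d : ℕ} (ψ : Pt d → ℝ) (r : ℝ) (m : Pt d) : ℝ :=
  -(2 ^ (d + 1)) * m.1 * r ^ (-(4 * (d : ℤ) + 2) - 1) * ψ (psiArg r m)

/-- First coefficient of the forcing matrix `F_{m₀}(r)`: `(1/m₀) ∂_r (ġ₁(r)/(2r))`. -/
def F1 (m0 r : ℝ) : ℝ := (1 / m0) * deriv h1 r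

/-- Second coefficient of the forcing matrix `F_{m₀}(r)`: `∂_r (ġ₂(r)/(2r))`. -/
def F2 (r : ℝ) : ℝ := deriv h2 r

/-- The kernel `K⃗_r(s,y,w) = −2^d r^{−Q} ψ(⋯) F_{s/r²}(r) A_{s/r²}(r)⁻¹ (y,w)ᵀ ∈ ℝ^d`. -/
def Kvec {d : ℕ} (ψ : Pt d → ℝ) (r : ℝ) (m : Pt d) : V d :=
  (-(2 ^ d) * r ^ (-(4 * (d : ℤ) + 2)) * ψ (psiArg r m)) •
    (F1 (m.1 / r ^ 2) r • (act ((Am (m.1 / r ^ 2) r)⁻¹) (m.2.1, m.2.2)).1 +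
      F2 r • (act ((Am (m.1 / r ^ 2) r)⁻¹) (m.2.1, m.2.2)).2)

/-- The gradient of `u : ℝ^{1+2d} → ℝ` in the `x`-variables (the `m₁` block). -/
def gradX {d : ℕ} (u : Pt d → ℝ) (z : Pt d) : V d :=
  mkV fun i => fderiv ℝ u z (0, EuclideanSpace.single i 1, 0)

/-- The gradient of `u : ℝ^{1+2d} → ℝ` in the `v`-variables (the `m₂` block). -/
def gradV {d : ℕ} (u : Pt d → ℝ) (z : Pt d) : V d :=
  mkV fun i => fderiv ℝ u z (0, 0, EuclideanSpace.single i 1)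

/-- The kernel `K⃗^π_r(s,y,w)
  = 2^{d+1} s r^{−Q−1} [(A_{s/r²}(r)⁻¹)_{·;2}]ᵀ [∇_{(m₁,m₂)}ψ](⋯) ∈ ℝ^d`. -/
def Kpi {d : ℕ} (ψ : Pt d → ℝ) (r : ℝ) (m : Pt d) : V d :=
  (2 ^ (d + 1) * m.1 * r ^ (-(4 * (d : ℤ) + 2) - 1)) •
    ((Am (m.1 / r ^ 2) r)⁻¹ 0 1 • gradX ψ (psiArg r m) +
      (Am (m.1 / r ^ 2) r)⁻¹ 1 1 • gradV ψ (psiArg r m))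

/-- Kinetic convolution operator for scalar kernels:
`[T_J f](z) = ∫ J(z⁻¹ ∘ m) f(m) dm`. -/
def Tsc {d : ℕ} (J : Pt d → ℝ) (f : Pt d → ℝ) (z : Pt d) : ℝ :=
  ∫ m, J (kmul (kinv z) m) * f m

/-- Kinetic convolution operator for `ℝ^d`-valued kernels:
`[T_J f](z) = ∫ J(z⁻¹ ∘ m) · f(m) dm`. -/
def Tvec {d : ℕ} (J : Pt d → V d) (f : Pt d → V d) (z : Pt d) : ℝ :=
  ∫ m, ⟪J (kmul (kinv z) m), f m⟫

/-- The support and nonnegativity conditions on the bump function `ψ`: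
smooth, nonnegative, unit mass, supported in `(−2,−1) × B₁(0) × B₁(0)`. -/
structure IsKineticBump {d : ℕ} (ψ : Pt d → ℝ) : Prop where
  smooth : ContDiff ℝ (⊤ : ℕ∞) ψ
  nonneg : ∀ m, 0 ≤ ψ m
  mass : ∫ m, ψ m = 1
  supp : ∀ m : Pt d, ψ m ≠ 0 →
    m.1 ∈ Set.Ioo (-2 : ℝ) (-1) ∧ ‖m.2.1‖ < 1 ∧ ‖m.2.2‖ < 1

/-- The kinetic box `B_r^kin = {(s,y,w) : |s| < r², |y| < r³, |w| < r}`. -/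
def kinBox (d : ℕ) (r : ℝ) : Set (Pt d) :=
  {m | |m.1| < r ^ 2 ∧ ‖m.2.1‖ < r ^ 3 ∧ ‖m.2.2‖ < r}

lemma integrable_symmDiff_weight {d : ℕ} (hd : 1 ≤ d) :
    Integrable (fun h : V d => min 4 (2 * ‖h‖) * ‖h‖ ^ (-(d : ℝ) - 1 / 3)) := by
  have : Nonempty (Fin d) := ⟨⟨0, hd⟩⟩
  have : Nontrivial (V d) := by
    rw [← Module.finrank_pos_iff (R := ℝ)]
    simp; omega
  have hexp : ∀ (e : ℝ) {y : ℝ}, 0 < y →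
      y ^ (d - 1) * (y ^ e * y ^ (-(d : ℝ) - 1 / 3)) = y ^ (e - 4 / 3) := by
    intro e y hy
    rw [← Real.rpow_natCast, ← Real.rpow_add hy, ← Real.rpow_add hy]
    congr 1
    push_cast [Nat.cast_sub hd]
    ring
  have hmeas : Measurable fun y : ℝ =>
      y ^ (d - 1) • (min 4 (2 * y) * y ^ (-(d : ℝ) - 1 / 3)) := by fun_prop
  refine (integrable_fun_norm_addHaar (E := V d) (F := ℝ) volume
    (f := fun r => min 4 (2 * r) * r ^ (-(d : ℝ) - 1 / 3))).2 ?_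
  simp only [finrank_euclideanSpace, Fintype.card_fin]
  rw [← Set.Ioc_union_Ioi_eq_Ioi (zero_le_one' ℝ)]
  refine IntegrableOn.union ?_ ?_
  · have h0 : IntegrableOn (fun y : ℝ => 2 * y ^ (-(1 / 3) : ℝ)) (Set.Ioc 0 1) := by
      refine Integrable.const_mul ?_ 2
      exact (intervalIntegrable_iff_integrableOn_Ioc_of_le zero_le_one).1
        (intervalIntegral.intervalIntegrable_rpow' (by norm_num))
    refine Integrable.mono' h0 hmeas.aestronglyMeasurable ?_
    refine (ae_restrict_iff' measurableSet_Ioc).2 (ae_of_all _ fun y hy => ?_)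
    have hy0 : 0 < y := hy.1
    have h2 := hexp 1 hy0
    rw [Real.rpow_one] at h2
    have h3 : (1 : ℝ) - 4 / 3 = -(1 / 3) := by norm_num
    rw [h3] at h2
    rw [← h2, Real.norm_of_nonneg (by simp only [smul_eq_mul]; positivity), smul_eq_mul]
    calc y ^ (d - 1) * (min 4 (2 * y) * y ^ (-(d : ℝ) - 1 / 3))
        ≤ y ^ (d - 1) * ((2 * y) * y ^ (-(d : ℝ) - 1 / 3)) := by gcongr; exact min_le_right _ _
      _ = _ := by ring
  · have h0 : IntegrableOn (fun y : ℝ => 4 * y ^ (-(4 / 3) : ℝ)) (Set.Ioi 1) :=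
      Integrable.const_mul (integrableOn_Ioi_rpow_of_lt (by norm_num) one_pos) 4
    refine Integrable.mono' h0 hmeas.aestronglyMeasurable ?_
    refine (ae_restrict_iff' measurableSet_Ioi).2 (ae_of_all _ fun y hy => ?_)
    have hy0 : 0 < y := one_pos.trans hy
    have h2 := hexp 0 hy0
    rw [Real.rpow_zero, zero_sub] at h2
    rw [← h2, Real.norm_of_nonneg (by simp only [smul_eq_mul]; positivity), smul_eq_mul]
    calc y ^ (d - 1) * (min 4 (2 * y) * y ^ (-(d : ℝ) - 1 / 3))
        ≤ y ^ (d - 1) * (4 * y ^ (-(d : ℝ) - 1 / 3)) := by gcongr; exact min_le_left _ _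
      _ = _ := by ring

/-- The symmetric-difference singular integral of a bounded Lipschitz function supported in the
unit ball decays like `|u|^{-d-1/3}`. -/
lemma exists_symmDiff_integral_decay {d : ℕ} (hd : 1 ≤ d) :
    ∃ C : ℝ, 0 ≤ C ∧ ∀ (M : ℝ) (Φ : V d → ℝ), (∀ u, |Φ u| ≤ M) →
      (∀ u v, |Φ u - Φ v| ≤ M * ‖u - v‖) → (∀ u, Φ u ≠ 0 → ‖u‖ < 1) → ∀ u,
      |∫ h : V d, (2 * Φ u - Φ (u + h) - Φ (u - h)) * ‖h‖ ^ (-(d : ℝ) - 1 / 3)| ≤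
        C * M * (1 + ‖u‖) ^ (-((d : ℝ) + 1 / 3)) := by
  set p : ℝ := (d : ℝ) + 1 / 3 with hp
  have hp0 : 0 < p := by positivity
  have hpe : -(d : ℝ) - 1 / 3 = -p := by rw [hp]; ring
  set C₁ := ∫ h : V d, min 4 (2 * ‖h‖) * ‖h‖ ^ (-(d : ℝ) - 1 / 3) with hC₁
  have hC₁0 : 0 ≤ C₁ := integral_nonneg fun h => by positivity
  set v := volume.real (Metric.ball (0 : V d) 1)
  have hv0 : 0 ≤ v := measureReal_nonneg
  refine ⟨3 ^ p * C₁ + 2 * v * (1 / 4) ^ (-p), by positivity, fun M Φ hb hL hs u => ?_⟩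
  have hM : 0 ≤ M := (abs_nonneg _).trans (hb 0)
  have hpos : 0 < 1 + ‖u‖ := by positivity
  have hA : 0 ≤ 3 ^ p * C₁ := by positivity
  have hB : 0 ≤ 2 * v * (1 / 4) ^ (-p) := by positivity
  have hdec : 0 ≤ (1 + ‖u‖) ^ (-p) := by positivity
  rcases le_or_gt ‖u‖ 2 with hu | hu
  · have h1 : |∫ h : V d, (2 * Φ u - Φ (u + h) - Φ (u - h)) * ‖h‖ ^ (-(d : ℝ) - 1 / 3)| ≤
        M * C₁ := by
      rw [hC₁, ← integral_const_mul, ← Real.norm_eq_abs]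
      refine norm_integral_le_of_norm_le (μ := volume) ((integrable_symmDiff_weight hd).const_mul M)
        (ae_of_all _ fun h => ?_)
      rw [norm_mul, Real.norm_of_nonneg (Real.rpow_nonneg (norm_nonneg h) _), ← mul_assoc]
      gcongr
      rw [Real.norm_eq_abs, mul_min_of_nonneg _ _ hM]
      refine le_min ?_ ?_
      · have a1 := abs_le.1 (hb u); have a2 := abs_le.1 (hb (u + h))
        have a3 := abs_le.1 (hb (u - h))
        rw [abs_le]; constructor <;> linarith
      · have a1 := hL u (u + h)
        have a2 := hL u (u - h)
        simp only [sub_add_cancel_left, norm_neg, sub_sub_self] at a1 a2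
        rw [abs_le] at a1 a2 ⊢
        constructor <;> linarith
    have h2 : (1 : ℝ) ≤ 3 ^ p * (1 + ‖u‖) ^ (-p) := by
      rw [Real.rpow_neg hpos.le, ← div_eq_mul_inv, one_le_div (by positivity)]
      exact Real.rpow_le_rpow hpos.le (by linarith) hp0.le
    calc _ ≤ M * C₁ := h1
      _ ≤ M * C₁ * (3 ^ p * (1 + ‖u‖) ^ (-p)) := le_mul_of_one_le_right (by positivity) h2
      _ = (3 ^ p * C₁) * M * (1 + ‖u‖) ^ (-p) := by ring
      _ ≤ _ := mul_le_mul_of_nonneg_right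
        (mul_le_mul_of_nonneg_right (le_add_of_nonneg_right hB) hM) hdec
  · have hz : ∀ y : V d, 1 ≤ ‖y‖ → Φ y = 0 := fun y hy => by
      by_contra hne
      exact absurd (hs y hne) (not_lt.2 hy)
    have hu0 : Φ u = 0 := hz u (by linarith)
    set K := M * ((1 / 4) ^ (-p) * (1 + ‖u‖) ^ (-p)) with hK
    have hK0 : 0 ≤ K := by positivity
    have key : ∀ (y h : V d), ‖h‖ = ‖y - u‖ →
        |Φ y| * ‖h‖ ^ (-p) ≤ (Metric.ball (0 : V d) 1).indicator (fun _ => K) y := by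
      intro y h hh
      by_cases hy : ‖y‖ < 1
      · rw [Set.indicator_of_mem (by simpa using hy), hK]
        have h3 : (1 / 4) * (1 + ‖u‖) ≤ ‖h‖ := by
          have := norm_sub_norm_le u y
          rw [norm_sub_rev] at this
          linarith
        rw [← Real.mul_rpow (by norm_num) hpos.le]
        exact mul_le_mul (hb y)
          (Real.rpow_le_rpow_of_nonpos (by positivity) h3 (neg_nonpos.2 hp0.le))
          (Real.rpow_nonneg (norm_nonneg h) _) hM
      · rw [hz y (not_lt.1 hy), abs_zero, zero_mul]
        exact Set.indicator_nonneg (fun _ _ => hK0) _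
    have hI : Integrable ((Metric.ball (0 : V d) 1).indicator fun _ => K) :=
      (integrable_indicator_iff Metric.isOpen_ball.measurableSet).2
        (integrableOn_const measure_ball_lt_top.ne)
    have hIv : ∫ y, (Metric.ball (0 : V d) 1).indicator (fun _ => K) y = v * K := by
      rw [integral_indicator_const _ Metric.isOpen_ball.measurableSet, smul_eq_mul]
    have h1 : |∫ h : V d, (2 * Φ u - Φ (u + h) - Φ (u - h)) * ‖h‖ ^ (-(d : ℝ) - 1 / 3)| ≤
        ∫ h, ((Metric.ball (0 : V d) 1).indicator (fun _ => K) (u + h) +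
          (Metric.ball (0 : V d) 1).indicator (fun _ => K) (u - h)) := by
      rw [← Real.norm_eq_abs]
      refine norm_integral_le_of_norm_le (μ := volume)
        (g := fun h => (Metric.ball (0 : V d) 1).indicator (fun _ => K) (u + h) +
          (Metric.ball (0 : V d) 1).indicator (fun _ => K) (u - h))
        ((hI.comp_add_left u).add (hI.comp_sub_left u)) (ae_of_all _ fun h => ?_)
      rw [norm_mul, Real.norm_of_nonneg (Real.rpow_nonneg (norm_nonneg h) _), hu0, hpe]
      have k1 := key (u + h) h (by simp)
      have k2 := key (u - h) h (by simp)
      refine le_trans ?_ (add_le_add k1 k2)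
      rw [← add_mul]
      gcongr
      rw [Real.norm_eq_abs, ← abs_neg (Φ (u + h)), ← abs_neg (Φ (u - h))]
      refine le_trans (le_of_eq ?_) (abs_add_le _ _)
      congr 1; ring
    rw [integral_add (hI.comp_add_left u) (hI.comp_sub_left u),
      integral_add_left_eq_self (fun y => (Metric.ball (0 : V d) 1).indicator (fun _ => K) y) u,
      integral_sub_left_eq_self (fun y => (Metric.ball (0 : V d) 1).indicator (fun _ => K) y)
        volume u, hIv] at h1
    calc _ ≤ v * K + v * K := h1
      _ = (2 * v * (1 / 4) ^ (-p)) * M * (1 + ‖u‖) ^ (-p) := by rw [hK]; ring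
      _ ≤ _ := mul_le_mul_of_nonneg_right
        (mul_le_mul_of_nonneg_right (le_add_of_nonneg_left hA) hM) hdec

/-- The rescaled form of the decay estimate, for functions supported in a ball of radius `R`. -/
lemma exists_symmDiff_integral_decay_scaled {d : ℕ} (hd : 1 ≤ d) :
    ∃ C : ℝ, 0 ≤ C ∧ ∀ (R : ℝ), 0 < R → ∀ (M : ℝ) (φ : V d → ℝ), (∀ y, |φ y| ≤ M) →
      (∀ y z, |φ y - φ z| ≤ M * (R⁻¹ * ‖y - z‖)) → (∀ y, φ y ≠ 0 → ‖y‖ < R) → ∀ y,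
      |∫ h : V d, (2 * φ y - φ (y + h) - φ (y - h)) * ‖h‖ ^ (-(d : ℝ) - 1 / 3)| ≤
        C * M * R ^ (-(1 / 3) : ℝ) * (1 + ‖R⁻¹ • y‖) ^ (-((d : ℝ) + 1 / 3)) := by
  obtain ⟨C, hC, H⟩ := exists_symmDiff_integral_decay hd
  refine ⟨C, hC, fun R hR M φ hb hL hs y => ?_⟩
  have h1 := H M (fun u => φ (R • u)) (fun u => hb _) (fun u v => by
      have := hL (R • u) (R • v)
      rwa [← smul_sub, norm_smul, Real.norm_of_nonneg hR.le, inv_mul_cancel_left₀ hR.ne'] at this)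
    (fun u hu => by
      have := hs _ hu
      rw [norm_smul, Real.norm_of_nonneg hR.le] at this
      exact (mul_lt_iff_lt_one_right hR).1 this) (R⁻¹ • y)
  simp only [smul_add, smul_sub, smul_inv_smul₀ hR.ne'] at h1
  have h2 := Measure.integral_comp_smul (volume : Measure (V d))
    (fun h : V d => (2 * φ y - φ (y + h) - φ (y - h)) * ‖h‖ ^ (-(d : ℝ) - 1 / 3)) R
  simp only [norm_smul, Real.norm_of_nonneg hR.le, finrank_euclideanSpace, Fintype.card_fin,
    Real.mul_rpow hR.le (norm_nonneg _), smul_eq_mul] at h2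
  have h3 : ∀ h : V d, (2 * φ y - φ (y + R • h) - φ (y - R • h)) *
      (R ^ (-(d : ℝ) - 1 / 3) * ‖h‖ ^ (-(d : ℝ) - 1 / 3)) =
      R ^ (-(d : ℝ) - 1 / 3) * ((2 * φ y - φ (y + R • h) - φ (y - R • h)) *
        ‖h‖ ^ (-(d : ℝ) - 1 / 3)) := fun h => by ring
  simp only [h3, integral_const_mul] at h2
  rw [abs_of_pos (by positivity), eq_inv_mul_iff_mul_eq₀ (by positivity), ← mul_assoc,
    ← Real.rpow_natCast, ← Real.rpow_add hR,
    show (d : ℝ) + (-(d : ℝ) - 1 / 3) = -(1 / 3) by ring] at h2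
  rw [← h2, abs_mul, abs_of_pos (Real.rpow_pos_of_pos hR _)]
  calc _ ≤ R ^ (-(1 / 3) : ℝ) * (C * M * (1 + ‖R⁻¹ • y‖) ^ (-((d : ℝ) + 1 / 3))) := by gcongr
    _ = _ := by ring

lemma abs_g1_le {r : ℝ} (hr : 0 < r) : |g1 r| ≤ r ^ 3 := by
  rw [g1, abs_mul, abs_of_pos (by positivity : (0 : ℝ) < r ^ 3)]
  exact mul_le_of_le_one_right (by positivity) (Real.abs_sin_le_one _)

lemma abs_g2_le {r : ℝ} (hr : 0 < r) : |g2 r| ≤ r ^ 3 := by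
  rw [g2, abs_mul, abs_of_pos (by positivity : (0 : ℝ) < r ^ 3)]
  exact mul_le_of_le_one_right (by positivity) (Real.abs_cos_le_one _)

lemma abs_h1_le {r : ℝ} (hr : 0 < r) : |h1 r| ≤ 2 * r := by
  have hs := abs_le.1 (Real.abs_sin_le_one (Real.log r))
  have hc := abs_le.1 (Real.abs_cos_le_one (Real.log r))
  rw [h1, abs_mul, abs_of_pos (by positivity : (0 : ℝ) < r / 2)]
  have : |3 * Real.sin (Real.log r) + Real.cos (Real.log r)| ≤ 4 :=
    abs_le.2 ⟨by linarith, by linarith⟩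
  calc r / 2 * _ ≤ r / 2 * 4 := by gcongr
    _ = 2 * r := by ring

lemma abs_h2_le {r : ℝ} (hr : 0 < r) : |h2 r| ≤ 2 * r := by
  have hs := abs_le.1 (Real.abs_sin_le_one (Real.log r))
  have hc := abs_le.1 (Real.abs_cos_le_one (Real.log r))
  rw [h2, abs_mul, abs_of_pos (by positivity : (0 : ℝ) < r / 2)]
  have : |3 * Real.cos (Real.log r) - Real.sin (Real.log r)| ≤ 4 :=
    abs_le.2 ⟨by linarith, by linarith⟩
  calc r / 2 * _ ≤ r / 2 * 4 := by gcongr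
    _ = 2 * r := by ring

lemma Am_eq {m0 : ℝ} (hm : m0 ≠ 0) (r : ℝ) :
    Am m0 r = !![g1 r, m0 * g2 r; m0⁻¹ * h1 r, h2 r] := by
  have hD : (Dm m0)⁻¹ = !![m0⁻¹, 0; 0, 1] :=
    Matrix.inv_eq_right_inv (by simp [Dm, Matrix.one_fin_two, hm])
  rw [Am, hD, Dm, Wm]
  simp only [Matrix.mul_fin_two]
  ext i j
  fin_cases i <;> fin_cases j <;> simp <;> field_simp

lemma g1_mul_h2_sub (r : ℝ) : g1 r * h2 r - g2 r * h1 r = -(r ^ 4 / 2) := by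
  have := Real.sin_sq_add_cos_sq (Real.log r)
  rw [g1, g2, h1, h2]
  linear_combination (-(r ^ 4 / 2)) * this

lemma Am_inv {m0 r : ℝ} (hm : m0 ≠ 0) (hr : 0 < r) :
    (Am m0 r)⁻¹ = !![-(2 / r ^ 4) * h2 r, (2 / r ^ 4) * (m0 * g2 r);
      (2 / r ^ 4) * (m0⁻¹ * h1 r), -(2 / r ^ 4) * g1 r] := by
  have hdet := g1_mul_h2_sub r
  refine Matrix.inv_eq_right_inv ?_
  rw [Am_eq hm, Matrix.mul_fin_two, Matrix.one_fin_two]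
  have hr0 : r ≠ 0 := hr.ne'
  ext i j
  fin_cases i <;> fin_cases j <;> simp <;> field_simp
  all_goals first | linear_combination (-2) * hdet | ring

lemma act_mul {d : ℕ} (A B : Matrix (Fin 2) (Fin 2) ℝ) (p : V d × V d) :
    act (A * B) p = act A (act B p) := by
  simp only [act, Matrix.mul_apply, Fin.sum_univ_two, Prod.mk.injEq]
  constructor <;> module

lemma act_Am_act_inv {d : ℕ} {m0 r : ℝ} (hm : m0 ≠ 0) (hr : 0 < r) (p : V d × V d) :
    act (Am m0 r) (act (Am m0 r)⁻¹ p) = p := by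
  have hu : IsUnit (Am m0 r).det := by
    rw [Am_eq hm, Matrix.det_fin_two_of, isUnit_iff_ne_zero]
    have h := g1_mul_h2_sub r
    have h4 : (0 : ℝ) < r ^ 4 / 2 := by positivity
    have : m0 * g2 r * (m0⁻¹ * h1 r) = g2 r * h1 r := by field_simp
    rw [this, h]
    linarith
  rw [← act_mul, Matrix.mul_nonsing_inv _ hu]
  simp [act]

lemma norm_smul_add_smul_le {d : ℕ} {a b A B : ℝ} {u v : V d} (ha : |a| ≤ A) (hb : |b| ≤ B)
    (hB : 0 < B) (hu : ‖u‖ ≤ 1) (hv : ‖v‖ < 1) : ‖a • u + b • v‖ < A + B := by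
  refine (norm_add_le _ _).trans_lt (add_lt_add_of_le_of_lt ?_ ?_)
  · rw [norm_smul, Real.norm_eq_abs]
    calc |a| * ‖u‖ ≤ A * 1 := by gcongr; exact (abs_nonneg a).trans ha
      _ = A := mul_one A
  · rw [norm_smul, Real.norm_eq_abs]
    calc |b| * ‖v‖ ≤ B * ‖v‖ := by gcongr
      _ < B * 1 := by gcongr
      _ = B := mul_one B

/-- The mollification kernel is supported in a kinetic cylinder of size `r`. -/
lemma IsKineticBump.support_comp_psiArg {d : ℕ} {ψ : Pt d → ℝ} (hψ : IsKineticBump ψ) {r : ℝ}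
    (hr : 0 < r) {m : Pt d} (hm : ψ (psiArg r m) ≠ 0) :
    m.1 / r ^ 2 ∈ Set.Ioo (-2 : ℝ) (-1) ∧ ‖m.2.1‖ < 3 * r ^ 3 ∧ ‖m.2.2‖ < 4 * r := by
  obtain ⟨hs, hu, hv⟩ := hψ.supp _ hm
  refine ⟨hs, ?_⟩
  simp only [psiArg] at hs hu hv
  set m0 := m.1 / r ^ 2
  have hm0 : m0 ≠ 0 := by rintro h; rw [h] at hs; norm_num at hs
  have habs : |m0| ≤ 2 := abs_le.2 ⟨hs.1.le, by linarith [hs.2]⟩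
  have hinv : |m0⁻¹| ≤ 1 := by
    rw [abs_inv]
    exact inv_le_one_of_one_le₀ (by rw [abs_of_neg (by linarith [hs.2])]; linarith [hs.2])
  have h := act_Am_act_inv hm0 hr (m.2.1, m.2.2)
  generalize act (Am m0 r)⁻¹ (m.2.1, m.2.2) = q at h hu hv
  rw [Am_eq hm0, act, Prod.mk.injEq] at h
  simp only [Matrix.of_apply, Matrix.cons_val', Matrix.cons_val_zero, Matrix.cons_val_one,
    Matrix.cons_val_fin_one] at h
  have hg2 : |m0 * g2 r| ≤ 2 * r ^ 3 := by
    rw [abs_mul]; exact mul_le_mul habs (abs_g2_le hr) (abs_nonneg _) (by norm_num)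
  have hh1 : |m0⁻¹ * h1 r| ≤ 2 * r := by
    rw [abs_mul]
    exact (mul_le_mul hinv (abs_h1_le hr) (abs_nonneg _) zero_le_one).trans_eq (one_mul _)
  constructor
  · rw [← h.1]
    refine (norm_smul_add_smul_le (abs_g1_le hr) hg2 (by positivity) hu.le hv).trans_eq (by ring)
  · rw [← h.2]
    refine (norm_smul_add_smul_le hh1 (abs_h2_le hr) (by positivity) hu.le hv).trans_eq (by ring)

lemma norm_psiArg_sub_le {d : ℕ} {r s : ℝ} (hr : 0 < r) (hs : s / r ^ 2 ∈ Set.Ioo (-2 : ℝ) (-1))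
    (y z w : V d) :
    ‖psiArg r (s, y, w) - psiArg r (s, z, w)‖ ≤ 4 / r ^ 3 * ‖y - z‖ := by
  simp only [psiArg]
  set m0 := s / r ^ 2
  have hm0 : m0 ≠ 0 := by rintro h; rw [h] at hs; norm_num at hs
  have hinv : |m0⁻¹| ≤ 1 := by
    rw [abs_inv]
    exact inv_le_one_of_one_le₀ (by rw [abs_of_neg (by linarith [hs.2])]; linarith [hs.2])
  rw [Am_inv hm0 hr]
  simp only [act, Matrix.of_apply, Matrix.cons_val', Matrix.cons_val_zero, Matrix.cons_val_one,
    Matrix.cons_val_fin_one, Prod.mk_sub_mk, sub_self, add_sub_add_right_eq_sub, ← smul_sub]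
  have e : (4 : ℝ) / r ^ 3 = 2 / r ^ 4 * (2 * r) := by field_simp; norm_num
  have h4 : (0 : ℝ) < 2 / r ^ 4 := by positivity
  rw [Prod.norm_def, Prod.norm_def]
  simp only [norm_zero, norm_smul, norm_mul, norm_neg, Real.norm_eq_abs, abs_of_pos h4]
  refine max_le (by positivity) (max_le ?_ ?_)
  · rw [e]
    gcongr
    exact abs_h2_le hr
  · rw [e]
    have hh1 : |m0⁻¹| * |h1 r| ≤ 2 * r :=
      (mul_le_mul hinv (abs_h1_le hr) (abs_nonneg _) zero_le_one).trans_eq (one_mul _)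
    exact mul_le_mul_of_nonneg_right (mul_le_mul_of_nonneg_left hh1 h4.le) (norm_nonneg _)

lemma IsKineticBump.hasCompactSupport {d : ℕ} {ψ : Pt d → ℝ} (hψ : IsKineticBump ψ) :
    HasCompactSupport ψ := by
  refine HasCompactSupport.of_support_subset_isCompact (isCompact_closedBall (0 : Pt d) 2)
    fun m hm => ?_
  obtain ⟨hs, hu, hv⟩ := hψ.supp m hm
  rw [mem_closedBall_zero_iff, Prod.norm_def, Prod.norm_def]
  refine max_le ?_ (max_le (by linarith) (by linarith))
  exact abs_le.2 ⟨hs.1.le, by linarith [hs.2]⟩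

lemma IsKineticBump.exists_bound {d : ℕ} {ψ : Pt d → ℝ} (hψ : IsKineticBump ψ) :
    ∃ M : ℝ, 0 ≤ M ∧ (∀ m, |ψ m| ≤ M) ∧ ∀ m n, 12 * |ψ m - ψ n| ≤ M * ‖m - n‖ := by
  obtain ⟨B, hB⟩ := hψ.smooth.continuous.bounded_above_of_compact_support hψ.hasCompactSupport
  obtain ⟨L, hL⟩ := hψ.smooth.lipschitzWith_of_hasCompactSupport hψ.hasCompactSupport (by simp)
  refine ⟨max B (12 * L), le_max_of_le_right (by positivity),
    fun m => (hB m).trans (le_max_left _ _), fun m n => ?_⟩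
  have h := hL.norm_sub_le m n
  rw [Real.norm_eq_abs] at h
  calc 12 * |ψ m - ψ n| ≤ 12 * (L * ‖m - n‖) := by gcongr
    _ = 12 * L * ‖m - n‖ := by ring
    _ ≤ _ := by gcongr; exact le_max_right _ _

/-- Pointwise bound for the fractional derivative of the mollification kernel. -/
lemma IsKineticBump.exists_symmDiff_Kker_bound {d : ℕ} (hd : 1 ≤ d) {ψ : Pt d → ℝ}
    (hψ : IsKineticBump ψ) :
    ∃ C : ℝ, 0 ≤ C ∧ ∀ τ : ℝ, 0 < τ → ∀ m : Pt d,
      |∫ h : V d, (2 * Kker ψ τ m - Kker ψ τ (m.1, m.2.1 + h, m.2.2) -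
          Kker ψ τ (m.1, m.2.1 - h, m.2.2)) * ‖h‖ ^ (-(d : ℝ) - 1 / 3)| ≤
        C * τ ^ (-(4 * (d : ℤ) + 2)) * τ⁻¹ *
          ((Set.Icc (-2 * τ ^ 2) (-τ ^ 2)).indicator (fun _ => 1) m.1 *
            ((1 + ‖(3 * τ ^ 3)⁻¹ • m.2.1‖) ^ (-((d : ℝ) + 1 / 3)) *
              (Metric.ball (0 : V d) (4 * τ)).indicator (fun _ => 1) m.2.2)) := by
  obtain ⟨C, hC, H⟩ := exists_symmDiff_integral_decay_scaled hd
  obtain ⟨M, hM, hb, hL⟩ := hψ.exists_bound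
  refine ⟨C * (2 ^ d * M) * 3 ^ (-(1 / 3) : ℝ), by positivity, fun τ hτ => ?_⟩
  rintro ⟨s, y, w⟩
  dsimp only
  set q : ℝ := 2 ^ d * τ ^ (-(4 * (d : ℤ) + 2)) with hq
  have hq0 : 0 < q := by positivity
  by_cases hsw : s / τ ^ 2 ∈ Set.Ioo (-2 : ℝ) (-1) ∧ ‖w‖ < 4 * τ
  · obtain ⟨hs, hw⟩ := hsw
    have hsI : s ∈ Set.Icc (-2 * τ ^ 2) (-τ ^ 2) := by
      have hτ2 : 0 < τ ^ 2 := by positivity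
      have h1 := (lt_div_iff₀ hτ2).1 hs.1
      have h2 := (div_lt_iff₀ hτ2).1 hs.2
      exact ⟨h1.le, by linarith⟩
    rw [Set.indicator_of_mem hsI, Set.indicator_of_mem (by simpa using hw), one_mul, mul_one]
    have h := H (3 * τ ^ 3) (by positivity) (q * M) (fun y => Kker ψ τ (s, y, w))
      (fun y => by
        rw [Kker, abs_mul, abs_of_pos hq0]
        gcongr
        exact hb _)
      (fun y z => by
        rw [Kker, Kker, ← mul_sub, abs_mul, abs_of_pos hq0, mul_assoc q]
        refine mul_le_mul_of_nonneg_left ?_ hq0.le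
        have h1 := hL (psiArg τ (s, y, w)) (psiArg τ (s, z, w))
        have h2 := mul_le_mul_of_nonneg_left (norm_psiArg_sub_le hτ hs y z w) hM
        have h3 : M * (4 / τ ^ 3 * ‖y - z‖) = 12 * (M * ((3 * τ ^ 3)⁻¹ * ‖y - z‖)) := by
          field_simp; ring
        linarith)
      (fun y hy => (hψ.support_comp_psiArg hτ (right_ne_zero_of_mul hy)).2.1) y
    refine h.trans_eq ?_
    have h3 : (3 * τ ^ 3) ^ (-(1 / 3) : ℝ) = 3 ^ (-(1 / 3) : ℝ) * τ⁻¹ := by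
      rw [Real.mul_rpow (by norm_num) (by positivity), ← Real.rpow_natCast, ← Real.rpow_mul hτ.le,
        ← Real.rpow_neg_one]
      norm_num
    rw [h3, hq]
    ring
  · have hz : ∀ y : V d, Kker ψ τ (s, y, w) = 0 := fun y => by
      by_contra hne
      obtain ⟨h1, -, h2⟩ := hψ.support_comp_psiArg hτ (right_ne_zero_of_mul hne)
      exact hsw ⟨h1, h2⟩
    simp only [hz, mul_zero, sub_self, zero_mul, integral_zero, abs_zero]
    refine mul_nonneg (by positivity) (mul_nonneg ?_ (mul_nonneg (by positivity) ?_)) <;>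
    exact Set.indicator_nonneg (fun _ _ => zero_le_one) _

/-- **L¹ bound for the fractional derivative of the mollification kernel**
(Step 5 of the proof of Theorem 4.2). There is `C > 0` such that for every `τ > 0`,
`‖𝔇_y K_τ‖_{L¹} ≤ C τ⁻¹`, where `𝔇_y` is the order-`1/3` symmetric-difference singular
integral acting in the spatial kernel variable `y`. -/
theorem statement17 (d : ℕ) (hd : 1 ≤ d) (ψ : Pt d → ℝ) (hψ : IsKineticBump ψ) :
    ∃ C : ℝ, 0 < C ∧ ∀ τ : ℝ, 0 < τ →
      (∫ m : Pt d,
        |∫ h : V d, (2 * Kker ψ τ m - Kker ψ τ (m.1, m.2.1 + h, m.2.2) -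
            Kker ψ τ (m.1, m.2.1 - h, m.2.2)) * ‖h‖ ^ (-(d : ℝ) - 1 / 3)|) ≤ C * τ⁻¹ := by
  obtain ⟨C, hC, H⟩ := hψ.exists_symmDiff_Kker_bound hd
  set p : ℝ := (d : ℝ) + 1 / 3 with hp
  set I := ∫ u : V d, (1 + ‖u‖) ^ (-p) with hI
  have hI0 : 0 ≤ I := integral_nonneg fun u => by positivity
  set v := volume.real (Metric.ball (0 : V d) 1) with hv
  have hv0 : 0 ≤ v := measureReal_nonneg
  have hint : Integrable fun u : V d => (1 + ‖u‖) ^ (-p) :=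
    integrable_one_add_norm (by simp [hp])
  refine ⟨C * (3 ^ d * I * (4 ^ d * v)) + 1, by positivity, fun τ hτ => ?_⟩
  have hR : (0 : ℝ) < 3 * τ ^ 3 := by positivity
  have iS : Integrable ((Set.Icc (-2 * τ ^ 2) (-τ ^ 2)).indicator fun _ => (1 : ℝ)) :=
    (integrable_indicator_iff measurableSet_Icc).2 (integrableOn_const measure_Icc_lt_top.ne)
  have iY : Integrable fun y : V d => (1 + ‖(3 * τ ^ 3)⁻¹ • y‖) ^ (-p) :=
    hint.comp_smul (inv_ne_zero hR.ne')
  have iW : Integrable ((Metric.ball (0 : V d) (4 * τ)).indicator fun _ => (1 : ℝ)) :=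
    (integrable_indicator_iff Metric.isOpen_ball.measurableSet).2
      (integrableOn_const measure_ball_lt_top.ne)
  have eS : ∫ s, (Set.Icc (-2 * τ ^ 2) (-τ ^ 2)).indicator (fun _ => (1 : ℝ)) s = τ ^ 2 := by
    rw [integral_indicator_const _ measurableSet_Icc, Real.volume_real_Icc_of_le (by nlinarith)]
    simp only [smul_eq_mul]
    ring
  have eY : ∫ y : V d, (1 + ‖(3 * τ ^ 3)⁻¹ • y‖) ^ (-p) = (3 * τ ^ 3) ^ d * I := by
    rw [Measure.integral_comp_smul volume (fun u : V d => (1 + ‖u‖) ^ (-p)) (3 * τ ^ 3)⁻¹,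
      finrank_euclideanSpace, Fintype.card_fin, inv_pow, inv_inv, abs_of_pos (by positivity),
      smul_eq_mul]
  have eW : ∫ w : V d, (Metric.ball (0 : V d) (4 * τ)).indicator (fun _ => (1 : ℝ)) w =
      (4 * τ) ^ d * v := by
    rw [integral_indicator_const _ Metric.isOpen_ball.measurableSet, smul_eq_mul, mul_one,
      measureReal_def, Measure.addHaar_ball_of_pos _ _ (by positivity), ENNReal.toReal_mul,
      finrank_euclideanSpace, Fintype.card_fin, ENNReal.toReal_ofReal (by positivity), hv,
      measureReal_def]
  have hmono := integral_mono_of_nonneg (ae_of_all _ fun m => abs_nonneg _)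
    ((iS.mul_prod (iY.mul_prod iW)).const_mul (C * τ ^ (-(4 * (d : ℤ) + 2)) * τ⁻¹))
    (ae_of_all _ fun m => H τ hτ m)
  refine hmono.trans ?_
  rw [integral_const_mul, integral_prod_mul
    ((Set.Icc (-2 * τ ^ 2) (-τ ^ 2)).indicator fun _ => (1 : ℝ))
    (fun z : V d × V d => (1 + ‖(3 * τ ^ 3)⁻¹ • z.1‖) ^ (-p) *
      (Metric.ball (0 : V d) (4 * τ)).indicator (fun _ => (1 : ℝ)) z.2),
    integral_prod_mul (fun y : V d => (1 + ‖(3 * τ ^ 3)⁻¹ • y‖) ^ (-p))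
      ((Metric.ball (0 : V d) (4 * τ)).indicator fun _ => (1 : ℝ)), eS, eY, eW]
  have hpow : τ ^ (-(4 * (d : ℤ) + 2)) * (τ ^ 2 * ((τ ^ 3) ^ d * τ ^ d)) = 1 := by
    rw [zpow_neg, show (4 * (d : ℤ) + 2) = ((4 * d + 2 : ℕ) : ℤ) by push_cast; ring, zpow_natCast,
      inv_mul_eq_one₀ (by positivity)]
    ring
  rw [mul_pow, mul_pow]
  calc _ = C * (3 ^ d * I * (4 ^ d * v)) * τ⁻¹ *
        (τ ^ (-(4 * (d : ℤ) + 2)) * (τ ^ 2 * ((τ ^ 3) ^ d * τ ^ d))) := by ring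
    _ = C * (3 ^ d * I * (4 ^ d * v)) * τ⁻¹ := by rw [hpow, mul_one]
    _ ≤ _ := by gcongr; exact le_add_of_nonneg_right zero_le_one
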